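/- arXiv:1202.1675 — 5 statements merged into one kernel-verified Lean document; each statement's English description precedes it below -/
import Mathlib

section
/- Let n ≥ 1. There exist constants C > 0 and c > 0 such that for all x, y ∈ ℝⁿ and all s > 0, W_s(x,y) ≤ C e^{-c(|x-y|² + (|x|+|y|)|x-y|)} · e^{-ns - c|x-y|²/s - c(1-e^{-2s})|x+y|²} / (1-e^{-4s})^{n/2}. -/
open Real MeasureTheory Set

/-- The Mehler (Hermite heat) kernel on ℝⁿ. -/
noncomputable def W (n : ℕ) (s : ℝ) (x y : EuclideanSpace ℝ (Fin n)) : ℝ :=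
  (Real.exp (-2 * s) / (Real.pi * (1 - Real.exp (-4 * s)))) ^ ((n : ℝ) / 2) *
    Real.exp (-(1 / 4) * ((1 + Real.exp (-2 * s)) / (1 - Real.exp (-2 * s)) * ‖x - y‖ ^ 2 +
      (1 - Real.exp (-2 * s)) / (1 + Real.exp (-2 * s)) * ‖x + y‖ ^ 2))

/-- The norms of two vectors sum to at most the norms of their difference and sum. -/
lemma norm_add_norm_le_norm_sub_add_norm_add {E : Type*} [NormedAddCommGroup E]
    [NormedSpace ℝ E] (x y : E) : ‖x‖ + ‖y‖ ≤ ‖x - y‖ + ‖x + y‖ := by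
  have hx : 2 * ‖x‖ ≤ ‖x - y‖ + ‖x + y‖ := by
    calc 2 * ‖x‖ = ‖(x - y) + (x + y)‖ := by
          rw [show (x - y) + (x + y) = (2 : ℝ) • x by rw [two_smul]; abel, norm_smul]; norm_num
      _ ≤ _ := norm_add_le _ _
  have hy : 2 * ‖y‖ ≤ ‖x - y‖ + ‖x + y‖ := by
    calc 2 * ‖y‖ = ‖(x + y) - (x - y)‖ := by
          rw [show (x + y) - (x - y) = (2 : ℝ) • y by rw [two_smul]; abel, norm_smul]; norm_num
      _ ≤ ‖x + y‖ + ‖x - y‖ := norm_sub_le _ _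
      _ = _ := add_comm _ _
  linarith

/-- The quadratic form in the exponent of the Mehler kernel dominates the Gaussian exponents. -/
lemma mehler_exponent_lower_bound {s a b m : ℝ} (hs : 0 < s) (ha : 0 ≤ a) (hm : m ≤ a + b) :
    1 / 18 * (a ^ 2 + m * a) + 1 / 18 * a ^ 2 / s + 1 / 18 * (1 - Real.exp (-2 * s)) * b ^ 2 ≤
      1 / 4 * ((1 + Real.exp (-2 * s)) / (1 - Real.exp (-2 * s)) * a ^ 2 +
        (1 - Real.exp (-2 * s)) / (1 + Real.exp (-2 * s)) * b ^ 2) := by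
  have ht : 0 < Real.exp (-2 * s) := Real.exp_pos _
  have ht1 : Real.exp (-2 * s) < 1 := Real.exp_lt_one_iff.2 (by linarith)
  have hts : 1 - Real.exp (-2 * s) ≤ 2 * s := by linarith [Real.add_one_le_exp (-2 * s)]
  generalize Real.exp (-2 * s) = t at *
  have hu : 0 < 1 - t := by linarith
  have hv : 0 < 1 + t := by linarith
  have hma : m * a ≤ (a + b) * a := mul_le_mul_of_nonneg_right hm ha
  have hA : a ^ 2 ≤ (1 + t) / (1 - t) * a ^ 2 :=
    le_mul_of_one_le_left (sq_nonneg a) ((one_le_div hu).2 (by linarith))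
  have hs' : a ^ 2 / s ≤ 2 * ((1 + t) / (1 - t) * a ^ 2) := by
    have h : 1 / s ≤ 2 * ((1 + t) / (1 - t)) := by
      rw [← mul_div_assoc, div_le_div_iff₀ hs hu]
      nlinarith
    calc a ^ 2 / s = 1 / s * a ^ 2 := by ring
      _ ≤ 2 * ((1 + t) / (1 - t)) * a ^ 2 := mul_le_mul_of_nonneg_right h (sq_nonneg a)
      _ = _ := by ring
  have hB : (1 - t) * b ^ 2 ≤ 2 * ((1 - t) / (1 + t) * b ^ 2) := by
    have h : 1 - t ≤ 2 * ((1 - t) / (1 + t)) := by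
      rw [← mul_div_assoc, le_div_iff₀ hv]
      nlinarith
    calc (1 - t) * b ^ 2 ≤ 2 * ((1 - t) / (1 + t)) * b ^ 2 :=
          mul_le_mul_of_nonneg_right h (sq_nonneg b)
      _ = _ := by ring
  have hab : 2 * (a * b) ≤ (1 + t) / (1 - t) * a ^ 2 + (1 - t) / (1 + t) * b ^ 2 := by
    have h : (1 + t) / (1 - t) * a ^ 2 + (1 - t) / (1 + t) * b ^ 2 - 2 * (a * b) =
        ((1 + t) * a - (1 - t) * b) ^ 2 / ((1 - t) * (1 + t)) := by
      field_simp
      ring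
    have : 0 ≤ ((1 + t) * a - (1 - t) * b) ^ 2 / ((1 - t) * (1 + t)) := by positivity
    linarith
  have hB0 : 0 ≤ (1 - t) / (1 + t) * b ^ 2 := by positivity
  rw [mul_div_assoc, mul_assoc (1 / 18 : ℝ) (1 - t)]
  nlinarith

/-- The normalizing factor of the Mehler kernel, with the constant `π` dropped. -/
lemma mehler_prefactor_le (n : ℕ) {s : ℝ} (hs : 0 < s) :
    (Real.exp (-2 * s) / (Real.pi * (1 - Real.exp (-4 * s)))) ^ ((n : ℝ) / 2) ≤
      Real.exp (-(n : ℝ) * s) / (1 - Real.exp (-4 * s)) ^ ((n : ℝ) / 2) := by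
  have hd : 0 < 1 - Real.exp (-4 * s) := by
    linarith [Real.exp_lt_one_iff.2 (show -4 * s < 0 by linarith)]
  calc _ ≤ (Real.exp (-2 * s) / (1 - Real.exp (-4 * s))) ^ ((n : ℝ) / 2) := by
        have hpi : 1 - Real.exp (-4 * s) ≤ Real.pi * (1 - Real.exp (-4 * s)) :=
          le_mul_of_one_le_left hd.le (by linarith [Real.pi_gt_three])
        gcongr
    _ = _ := by
        rw [Real.div_rpow (Real.exp_pos _).le hd.le, ← Real.exp_mul]
        congr 2
        ring

/-- Gaussian-type upper bound for the Mehler kernel. -/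
theorem mehler_kernel_bound (n : ℕ) (hn : 1 ≤ n) :
    ∃ C > (0 : ℝ), ∃ c > (0 : ℝ), ∀ (x y : EuclideanSpace ℝ (Fin n)) (s : ℝ), 0 < s →
      W n s x y ≤
        C * Real.exp (-c * (‖x - y‖ ^ 2 + (‖x‖ + ‖y‖) * ‖x - y‖)) *
          (Real.exp (-(n : ℝ) * s - c * ‖x - y‖ ^ 2 / s -
              c * (1 - Real.exp (-2 * s)) * ‖x + y‖ ^ 2) /
            (1 - Real.exp (-4 * s)) ^ ((n : ℝ) / 2)) := by
  refine ⟨1, one_pos, 1 / 18, by norm_num, fun x y s hs => ?_⟩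
  have hexp := mehler_exponent_lower_bound hs (norm_nonneg (x - y))
    (norm_add_norm_le_norm_sub_add_norm_add x y)
  have hd : 0 < 1 - Real.exp (-4 * s) := by
    linarith [Real.exp_lt_one_iff.2 (show -4 * s < 0 by linarith)]
  calc W n s x y
      ≤ Real.exp (-(n : ℝ) * s) / (1 - Real.exp (-4 * s)) ^ ((n : ℝ) / 2) *
          Real.exp (-(1 / 18 * (‖x - y‖ ^ 2 + (‖x‖ + ‖y‖) * ‖x - y‖) +
            1 / 18 * ‖x - y‖ ^ 2 / s + 1 / 18 * (1 - Real.exp (-2 * s)) * ‖x + y‖ ^ 2)) :=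
        mul_le_mul (mehler_prefactor_le n hs) (Real.exp_le_exp.2 (by linarith))
          (Real.exp_pos _).le (by positivity)
    _ = _ := by
        rw [one_mul, div_mul_eq_mul_div, mul_div_assoc', ← Real.exp_add, ← Real.exp_add]
        congr 2
        ring
end

section
/- Let n ≥ 1 and α > -n. There exist constants C > 0 and c > 0 such that for all x, y ∈ ℝⁿ and all t > 0, |Q_t^α(x,y)| ≤ C e^{-c(|x-y|² + (|x|+|y|)|x-y|)} · t/(t+|x-y|)^{n+1}; in particular |Q_t^α(x,y)| ≤ C t/(t+|x-y|)^{n+1}. -/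
open Real MeasureTheory Set

/-- Q_t^α(x,y) = t ∂_t P_t^α(x,y), where P_t^α is the Poisson kernel for the Hermite
operator shifted by α. -/
noncomputable def Q (n : ℕ) (α : ℝ) (t : ℝ) (x y : EuclideanSpace ℝ (Fin n)) : ℝ :=
  t / Real.sqrt (4 * Real.pi) *
    ∫ s in Set.Ioi (0 : ℝ), s ^ (-(3 : ℝ) / 2) * (1 - t ^ 2 / (2 * s)) *
      Real.exp (-t ^ 2 / (4 * s)) * Real.exp (-α * s) * W n s x y

lemma integrableOn_rpow_mul_exp_neg_div {b k : ℝ} (hb : 0 < b) (hk : 0 < k) :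
    IntegrableOn (fun s : ℝ => s ^ (-k - 1) * Real.exp (-b / s)) (Ioi 0) ∧
      ∫ s in Ioi (0 : ℝ), s ^ (-k - 1) * Real.exp (-b / s) = (1 / b) ^ k * Real.Gamma k := by
  have hcomp : EqOn (fun s : ℝ => s ^ (-k - 1) * Real.exp (-b / s))
      (fun s : ℝ => (|(-1 : ℝ)| * s ^ ((-1 : ℝ) - 1)) •
        ((s ^ (-1 : ℝ)) ^ (k - 1) * Real.exp (-(b * s ^ (-1 : ℝ))))) (Ioi 0) := by
    intro s hs
    have hs : 0 < s := hs
    simp only [abs_neg, abs_one, one_mul, smul_eq_mul]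
    rw [← mul_assoc, ← Real.rpow_mul hs.le, ← Real.rpow_add hs, Real.rpow_neg_one]
    congr 2 <;> ring_nf
  have hint : IntegrableOn (fun u : ℝ => u ^ (k - 1) * Real.exp (-(b * u))) (Ioi 0) := by
    have h := integrableOn_rpow_mul_exp_neg_mul_rpow (s := k - 1) (p := 1) (b := b)
      (by linarith) one_pos hb
    simpa [neg_mul] using h
  constructor
  · rw [integrableOn_congr_fun hcomp measurableSet_Ioi]
    exact (integrableOn_Ioi_comp_rpow_iff
      (fun u : ℝ => u ^ (k - 1) * Real.exp (-(b * u))) (by norm_num)).2 hint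
  · rw [setIntegral_congr_fun measurableSet_Ioi hcomp,
      integral_comp_rpow_Ioi (fun u : ℝ => u ^ (k - 1) * Real.exp (-(b * u))) (by norm_num),
      Real.integral_rpow_mul_exp_neg_mul_Ioi hk hb]

lemma exp_mul_mehler_prefactor_le (n : ℕ) (hn : 1 ≤ n) (α : ℝ) (hα : -(n : ℝ) < α) :
    ∃ M > (0 : ℝ), ∀ s > (0 : ℝ), Real.exp (-α * s) *
      (Real.exp (-2 * s) / (Real.pi * (1 - Real.exp (-4 * s)))) ^ ((n : ℝ) / 2) ≤
        M * s ^ (-((n : ℝ) / 2)) := by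
  have hn0 : (0 : ℝ) < n := by exact_mod_cast hn
  obtain ⟨ε, hε, rfl⟩ : ∃ ε > 0, α = n * ε - n :=
    ⟨(α + n) / n, div_pos (by linarith) hn0, by field_simp; ring⟩
  refine ⟨(1 + 2 / ε) ^ ((n : ℝ) / 2), by positivity, fun s hs => ?_⟩
  have hlt : Real.exp (-4 * s) < 1 := Real.exp_lt_one_iff.2 (by linarith)
  have hden : 4 * s / (1 + 4 * s) ≤ 1 - Real.exp (-4 * s) := by
    have h1 : Real.exp (-4 * s) ≤ (1 + 4 * s)⁻¹ := by
      rw [neg_mul, Real.exp_neg]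
      exact inv_anti₀ (by positivity) (by linarith [Real.add_one_le_exp (4 * s)])
    have h2 : 4 * s / (1 + 4 * s) = 1 - (1 + 4 * s)⁻¹ := by field_simp; ring
    linarith
  have hpos : 0 < 1 - Real.exp (-4 * s) := by linarith
  have hfac : Real.exp (-(n * ε - n) * s) = Real.exp (2 * s - 2 * ε * s) ^ ((n : ℝ) / 2) := by
    rw [← Real.exp_mul]; ring_nf
  have hnum : Real.exp (-(2 * ε * s)) ≤ (1 + 2 * ε * s)⁻¹ := by
    rw [Real.exp_neg]
    exact inv_anti₀ (by positivity) (by linarith [Real.add_one_le_exp (2 * ε * s)])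
  rw [hfac, ← Real.mul_rpow (by positivity) (by positivity), Real.rpow_neg hs.le,
    ← Real.inv_rpow hs.le, ← Real.mul_rpow (by positivity) (by positivity)]
  refine Real.rpow_le_rpow (by positivity) ?_ (by positivity)
  rw [← mul_div_assoc, ← Real.exp_add]
  have : 2 * s - 2 * ε * s + -2 * s = -(2 * ε * s) := by ring
  rw [this]
  have hπ : 4 * s / (1 + 4 * s) ≤ Real.pi * (1 - Real.exp (-4 * s)) := by
    nlinarith [Real.pi_gt_three]
  calc _ ≤ (1 + 2 * ε * s)⁻¹ / (4 * s / (1 + 4 * s)) := by gcongr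
    _ ≤ (1 + 2 / ε) * s⁻¹ := by
      rw [← sub_nonneg]
      have : (1 + 2 / ε) * s⁻¹ - (1 + 2 * ε * s)⁻¹ / (4 * s / (1 + 4 * s)) =
        (3 * ε + 8 + 12 * ε * s + 8 * ε ^ 2 * s) /
          (4 * ε * s * (1 + 2 * ε * s)) := by
        field_simp
        ring
      rw [this]
      positivity

lemma abs_one_sub_mul_exp_le {u : ℝ} (hu : 0 ≤ u) :
    |1 - 2 * u| * Real.exp (-u) ≤ 4 * Real.exp (-(u / 2)) := by
  have h1 : |1 - 2 * u| ≤ 4 * Real.exp (u / 2) := by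
    have := Real.add_one_le_exp (u / 2)
    rw [abs_le]; constructor <;> linarith
  calc _ ≤ 4 * Real.exp (u / 2) * Real.exp (-u) := by gcongr
    _ = _ := by rw [mul_assoc, ← Real.exp_add]; ring_nf

lemma mehler_exponent_le {n : ℕ} (x y : EuclideanSpace ℝ (Fin n)) {s : ℝ} (hs : 0 < s) :
    -(1 / 4) * ((1 + Real.exp (-2 * s)) / (1 - Real.exp (-2 * s)) * ‖x - y‖ ^ 2 +
      (1 - Real.exp (-2 * s)) / (1 + Real.exp (-2 * s)) * ‖x + y‖ ^ 2) ≤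
    -(1 / 32) * (‖x - y‖ ^ 2 + (‖x‖ + ‖y‖) * ‖x - y‖) + -(‖x - y‖ ^ 2 / (16 * s)) := by
  have hlt : Real.exp (-2 * s) < 1 := Real.exp_lt_one_iff.2 (by linarith)
  have hr := Real.exp_pos (-2 * s)
  have hr2 := Real.add_one_le_exp (-2 * s)
  have hsum : ‖x‖ + ‖y‖ ≤ ‖x - y‖ + ‖x + y‖ := by
    have hx : ‖(2 : ℝ) • x‖ ≤ ‖x - y‖ + ‖x + y‖ := by
      have : (2 : ℝ) • x = (x - y) + (x + y) := by module
      rw [this]; exact norm_add_le _ _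
    have hy : ‖(2 : ℝ) • y‖ ≤ ‖x - y‖ + ‖x + y‖ := by
      have : (2 : ℝ) • y = (x + y) - (x - y) := by module
      rw [this, add_comm ‖x - y‖]; exact norm_sub_le _ _
    rw [norm_smul] at hx hy
    norm_num at hx hy
    linarith
  generalize Real.exp (-2 * s) = r at *
  have ha := norm_nonneg (x - y)
  have hb := norm_nonneg (x + y)
  generalize ‖x - y‖ = a at *
  generalize ‖x + y‖ = b at *
  have hd : 0 < 1 - r := by linarith
  have hinv : (1 - r) / (1 + r) = ((1 + r) / (1 - r))⁻¹ := by rw [inv_div]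
  have hA1 : 1 ≤ (1 + r) / (1 - r) := by rw [le_div_iff₀ hd]; linarith
  have hAs : 1 / (2 * s) ≤ (1 + r) / (1 - r) := by
    rw [div_le_div_iff₀ (by positivity) hd]; nlinarith
  rw [hinv]
  generalize (1 + r) / (1 - r) = A at *
  have hA : 0 < A := by linarith
  have hamgm : 2 * (a * b) ≤ A * a ^ 2 + A⁻¹ * b ^ 2 := by
    have : A * a ^ 2 + A⁻¹ * b ^ 2 - 2 * (a * b) = (A * a - b) ^ 2 / A := by field_simp; ring
    have h2 : 0 ≤ (A * a - b) ^ 2 / A := by positivity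
    linarith
  have h1 : a ^ 2 ≤ A * a ^ 2 := by nlinarith [sq_nonneg a]
  have h2 : a ^ 2 / (16 * s) ≤ (1 / 8) * (A * a ^ 2) := by
    calc a ^ 2 / (16 * s) = (1 / 8) * (1 / (2 * s) * a ^ 2) := by field_simp; ring
      _ ≤ _ := by gcongr
  have h3 : 0 ≤ A⁻¹ * b ^ 2 := by positivity
  have h4 : (‖x‖ + ‖y‖) * a ≤ (a + b) * a := by gcongr
  nlinarith [mul_nonneg ha hb]

lemma exists_norm_Q_integrand_le (n : ℕ) (hn : 1 ≤ n) (α : ℝ) (hα : -(n : ℝ) < α) :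
    ∃ M > (0 : ℝ), ∀ (x y : EuclideanSpace ℝ (Fin n)) (t : ℝ), 0 < t → ∀ s > (0 : ℝ),
      ‖s ^ (-(3 : ℝ) / 2) * (1 - t ^ 2 / (2 * s)) *
        Real.exp (-t ^ 2 / (4 * s)) * Real.exp (-α * s) * W n s x y‖ ≤
      M * Real.exp (-(1 / 32) * (‖x - y‖ ^ 2 + (‖x‖ + ‖y‖) * ‖x - y‖)) *
        (s ^ (-(((n : ℝ) + 1) / 2) - 1) * Real.exp (-((t + ‖x - y‖) ^ 2 / 32) / s)) := by
  obtain ⟨M, hM, hbound⟩ := exp_mul_mehler_prefactor_le n hn α hα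
  refine ⟨4 * M, by positivity, fun x y t ht s hs => ?_⟩
  have hlt : Real.exp (-4 * s) < 1 := Real.exp_lt_one_iff.2 (by linarith)
  have hd : 0 < 1 - Real.exp (-4 * s) := by linarith
  have htime : |1 - t ^ 2 / (2 * s)| * Real.exp (-t ^ 2 / (4 * s)) ≤
      4 * Real.exp (-(t ^ 2 / (8 * s))) := by
    have h := abs_one_sub_mul_exp_le (u := t ^ 2 / (4 * s)) (by positivity)
    have h1 : 2 * (t ^ 2 / (4 * s)) = t ^ 2 / (2 * s) := by field_simp; ring
    have h2 : t ^ 2 / (4 * s) / 2 = t ^ 2 / (8 * s) := by field_simp; ring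
    rwa [h1, h2, ← neg_div] at h
  have hspace := Real.exp_le_exp.2 (mehler_exponent_le x y hs)
  rw [Real.exp_add] at hspace
  have hgauss : Real.exp (-(t ^ 2 / (8 * s))) * Real.exp (-(‖x - y‖ ^ 2 / (16 * s))) ≤
      Real.exp (-((t + ‖x - y‖) ^ 2 / 32) / s) := by
    rw [← Real.exp_add, Real.exp_le_exp]
    have : -((t + ‖x - y‖) ^ 2 / 32) / s -
        (-(t ^ 2 / (8 * s)) + -(‖x - y‖ ^ 2 / (16 * s))) =
        ((t - ‖x - y‖) ^ 2 + 2 * t ^ 2) / (32 * s) := by field_simp; ring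
    have h2 : 0 ≤ ((t - ‖x - y‖) ^ 2 + 2 * t ^ 2) / (32 * s) := by positivity
    linarith
  have hpow : s ^ (-(((n : ℝ) + 1) / 2) - 1) = s ^ (-(3 : ℝ) / 2) * s ^ (-((n : ℝ) / 2)) := by
    rw [← Real.rpow_add hs]; ring_nf
  have hpre := hbound s hs
  rw [W, hpow]
  set E := Real.exp (-(1 / 32) * (‖x - y‖ ^ 2 + (‖x‖ + ‖y‖) * ‖x - y‖))
  set F := Real.exp (-(1 / 4) * ((1 + Real.exp (-2 * s)) / (1 - Real.exp (-2 * s)) *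
    ‖x - y‖ ^ 2 + (1 - Real.exp (-2 * s)) / (1 + Real.exp (-2 * s)) * ‖x + y‖ ^ 2))
  set B := (Real.exp (-2 * s) / (Real.pi * (1 - Real.exp (-4 * s)))) ^ ((n : ℝ) / 2)
  have hB : 0 ≤ B := by positivity
  have hS : 0 < s ^ (-(3 : ℝ) / 2) := by positivity
  simp only [norm_mul, Real.norm_eq_abs, Real.abs_exp, abs_of_pos hS, abs_of_nonneg hB]
  have hF : |F| = F := Real.abs_exp _
  rw [hF]
  calc _ = s ^ (-(3 : ℝ) / 2) * (|1 - t ^ 2 / (2 * s)| * Real.exp (-t ^ 2 / (4 * s))) *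
        (Real.exp (-α * s) * B) * F := by ring
    _ ≤ s ^ (-(3 : ℝ) / 2) * (4 * Real.exp (-(t ^ 2 / (8 * s)))) *
        (M * s ^ (-((n : ℝ) / 2))) * (E * Real.exp (-(‖x - y‖ ^ 2 / (16 * s)))) := by
      gcongr
    _ = 4 * M * E * (s ^ (-(3 : ℝ) / 2) * s ^ (-((n : ℝ) / 2)) *
        (Real.exp (-(t ^ 2 / (8 * s))) * Real.exp (-(‖x - y‖ ^ 2 / (16 * s))))) := by ring
    _ ≤ _ := by gcongr

theorem Q_bound (n : ℕ) (hn : 1 ≤ n) (α : ℝ) (hα : -(n : ℝ) < α) :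
    ∃ C > (0 : ℝ), ∃ c > (0 : ℝ), ∀ (x y : EuclideanSpace ℝ (Fin n)) (t : ℝ), 0 < t →
      |Q n α t x y| ≤
          C * Real.exp (-c * (‖x - y‖ ^ 2 + (‖x‖ + ‖y‖) * ‖x - y‖)) *
            (t / (t + ‖x - y‖) ^ (n + 1)) ∧
        |Q n α t x y| ≤ C * (t / (t + ‖x - y‖) ^ (n + 1)) := by
  obtain ⟨M, hM, hbound⟩ := exists_norm_Q_integrand_le n hn α hα
  have hk : 0 < ((n : ℝ) + 1) / 2 := by positivity
  have hΓ := Real.Gamma_pos_of_pos hk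
  set K := (32 : ℝ) ^ (((n : ℝ) + 1) / 2) * Real.Gamma (((n : ℝ) + 1) / 2) with hK
  have hKpos : 0 < K := by positivity
  have hπ : 0 < Real.sqrt (4 * Real.pi) := Real.sqrt_pos.2 (by positivity)
  refine ⟨M * K / Real.sqrt (4 * Real.pi), by positivity, 1 / 32, by norm_num,
    fun x y t ht => ?_⟩
  have hd : 0 < t + ‖x - y‖ := by positivity
  set E := Real.exp (-(1 / 32) * (‖x - y‖ ^ 2 + (‖x‖ + ‖y‖) * ‖x - y‖)) with hE
  have hE1 : E ≤ 1 := by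
    rw [hE, Real.exp_le_one_iff]
    have : 0 ≤ ‖x - y‖ ^ 2 + (‖x‖ + ‖y‖) * ‖x - y‖ := by positivity
    linarith
  obtain ⟨hint, hval⟩ := integrableOn_rpow_mul_exp_neg_div
    (b := (t + ‖x - y‖) ^ 2 / 32) (by positivity) hk
  have hscale : (1 / ((t + ‖x - y‖) ^ 2 / 32)) ^ (((n : ℝ) + 1) / 2) =
      32 ^ (((n : ℝ) + 1) / 2) / (t + ‖x - y‖) ^ (n + 1) := by
    rw [one_div_div, Real.div_rpow (by norm_num) (by positivity), ← Real.rpow_natCast _ 2,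
      ← Real.rpow_mul hd.le, ← Real.rpow_natCast _ (n + 1)]
    congr 2
    push_cast
    ring
  have hintegral : |∫ s in Set.Ioi (0 : ℝ), s ^ (-(3 : ℝ) / 2) * (1 - t ^ 2 / (2 * s)) *
      Real.exp (-t ^ 2 / (4 * s)) * Real.exp (-α * s) * W n s x y| ≤
      M * E * (K / (t + ‖x - y‖) ^ (n + 1)) := by
    have h := norm_integral_le_of_norm_le (hint.const_mul (M * E))
      ((ae_restrict_iff' measurableSet_Ioi).2
        (Filter.Eventually.of_forall fun s hs => hbound x y t ht s hs))
    rw [integral_const_mul, hval, hscale] at h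
    refine h.trans (le_of_eq ?_)
    rw [hK]
    ring
  have hmain : |Q n α t x y| ≤ M * K / Real.sqrt (4 * Real.pi) * E *
      (t / (t + ‖x - y‖) ^ (n + 1)) := by
    rw [Q, abs_mul, abs_of_pos (div_pos ht hπ)]
    calc _ ≤ t / Real.sqrt (4 * Real.pi) * (M * E * (K / (t + ‖x - y‖) ^ (n + 1))) := by gcongr
      _ = _ := by ring
  refine ⟨hmain, hmain.trans ?_⟩
  have : M * K / Real.sqrt (4 * Real.pi) * E ≤ M * K / Real.sqrt (4 * Real.pi) :=
    mul_le_of_le_one_right (by positivity) hE1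
  gcongr
end

section
/- Let n ≥ 1 and α > -n. There exist constants C > 0 and c > 0 such that for all x, y ∈ ℝⁿ with x ≠ y, (∫_0^∞ Q_t^α(x,y)² dt/t)^{1/2} ≤ C e^{-c(|x-y|² + |y| |x-y|)} / |x-y|^n. -/
open Real MeasureTheory Set

/-- The exponential factor times the prefactor of the Mehler kernel is at most of size `s ^ (-n/2)`. -/
lemma exists_exp_mul_mehler_prefactor_le (n : ℕ) (hn : 1 ≤ n) (α : ℝ) (hα : -(n : ℝ) < α) :
    ∃ A > (0 : ℝ), ∀ s > (0 : ℝ),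
      exp (-α * s) * (exp (-2 * s) / (π * (1 - exp (-4 * s)))) ^ ((n : ℝ) / 2) ≤
        A * s ^ (-(n : ℝ) / 2) := by
  have hn0 : (0 : ℝ) < n := by exact_mod_cast hn
  set ε : ℝ := 2 * (α + n) / n with hε
  have hε0 : 0 < ε := div_pos (by linarith) hn0
  set M : ℝ := max 1 (4 / ε)
  have hM1 : 1 ≤ M := le_max_left _ _
  have hM4 : 4 ≤ M * ε := (div_le_iff₀ hε0).1 (le_max_right _ _)
  refine ⟨M ^ ((n : ℝ) / 2), by positivity, fun s hs => ?_⟩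
  have hq : exp (-4 * s) * (1 + 4 * s) ≤ 1 := by
    have h := add_one_le_exp (4 * s)
    calc exp (-4 * s) * (1 + 4 * s) ≤ exp (-4 * s) * exp (4 * s) := by gcongr; linarith
      _ = 1 := by rw [← exp_add]; simp
  have hq1 : exp (-4 * s) < 1 := exp_lt_one_iff.2 (by linarith)
  have hπ : 3 < π := pi_gt_three
  have hMs : 1 + 4 * s ≤ M * exp (ε * s) := by
    have h := add_one_le_exp (ε * s)
    calc 1 + 4 * s ≤ M * (ε * s + 1) := by nlinarith
      _ ≤ _ := by gcongr
  have hbase : exp (-2 * s) / (π * (1 - exp (-4 * s))) ≤ M * exp ((ε - 2) * s) * s⁻¹ := by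
    have he : exp ((ε - 2) * s) = exp (ε * s) * exp (-2 * s) := by rw [← exp_add]; ring_nf
    rw [he, div_le_iff₀ (by nlinarith)]
    have hX : s ≤ M * exp (ε * s) * (π * (1 - exp (-4 * s))) := by
      have h1 : s ≤ (1 + 4 * s) * (1 - exp (-4 * s)) := by nlinarith
      calc s ≤ (1 + 4 * s) * (1 - exp (-4 * s)) := h1
        _ ≤ (M * exp (ε * s)) * (π * (1 - exp (-4 * s))) := by
          gcongr
          nlinarith
    have hE := exp_pos (-2 * s)
    calc exp (-2 * s) = exp (-2 * s) * (s * s⁻¹) := by rw [mul_inv_cancel₀ hs.ne']; ring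
      _ ≤ exp (-2 * s) * ((M * exp (ε * s) * (π * (1 - exp (-4 * s)))) * s⁻¹) := by gcongr
      _ = _ := by ring
  have hbase0 : 0 ≤ exp (-2 * s) / (π * (1 - exp (-4 * s))) :=
    div_nonneg (exp_pos _).le (mul_nonneg pi_pos.le (by linarith))
  calc exp (-α * s) * (exp (-2 * s) / (π * (1 - exp (-4 * s)))) ^ ((n : ℝ) / 2)
      ≤ exp (-α * s) * (M * exp ((ε - 2) * s) * s⁻¹) ^ ((n : ℝ) / 2) := by gcongr
    _ = M ^ ((n : ℝ) / 2) * s ^ (-(n : ℝ) / 2) := by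
      rw [mul_rpow (by positivity) (by positivity), mul_rpow (by positivity) (by positivity),
        ← exp_mul, inv_rpow hs.le, ← rpow_neg hs.le]
      have h2 : (ε - 2) * s * ((n : ℝ) / 2) = α * s := by
        rw [hε]; field_simp; ring
      have h3 : exp (-α * s) * exp (α * s) = 1 := by rw [← exp_add]; simp
      rw [h2, neg_div]
      linear_combination (M ^ ((n : ℝ) / 2) * s ^ (-((n : ℝ) / 2))) * h3

/-- Lower bound for the quadratic form in the exponent of the Mehler kernel. -/
lemma mehler_exponent_ge {s : ℝ} (hs : 0 < s) {d z w : ℝ} (hd : 0 ≤ d)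
    (hw : w ≤ (z + d) / 2) :
    d ^ 2 / 32 / s + 1 / 24 * (d ^ 2 + w * d) ≤
      1 / 4 * ((1 + exp (-2 * s)) / (1 - exp (-2 * s)) * d ^ 2 +
        (1 - exp (-2 * s)) / (1 + exp (-2 * s)) * z ^ 2) := by
  have hq0 := exp_pos (-2 * s)
  have hq1 : exp (-2 * s) < 1 := exp_lt_one_iff.2 (by linarith)
  have hqs : 1 - exp (-2 * s) ≤ 2 * s := by linarith [add_one_le_exp (-2 * s)]
  generalize exp (-2 * s) = q at hq0 hq1 hqs ⊢
  have hr : 0 < 1 - q := by linarith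
  set P := (1 + q) / (1 - q) with hP
  have hP0 : 0 < P := by positivity
  have hR : (1 - q) / (1 + q) = P⁻¹ := by rw [hP, inv_div]
  have hP1 : 1 ≤ P := by rw [hP, le_div_iff₀ hr]; linarith
  have hPs : 1 / (2 * s) ≤ P := by
    rw [hP, div_le_div_iff₀ (by positivity) hr]; nlinarith
  rw [hR]
  have hsq : 2 * d * z ≤ P * d ^ 2 + P⁻¹ * z ^ 2 := by
    have h : P * d ^ 2 + P⁻¹ * z ^ 2 - 2 * d * z = P⁻¹ * (P * d - z) ^ 2 := by
      field_simp; ring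
    have : 0 ≤ P⁻¹ * (P * d - z) ^ 2 := by positivity
    linarith
  have h1 : d ^ 2 ≤ P * d ^ 2 := by nlinarith [sq_nonneg d]
  have h2 : d ^ 2 / 32 / s ≤ P * d ^ 2 / 16 := by
    have := mul_le_mul_of_nonneg_right hPs (sq_nonneg d)
    have e : d ^ 2 / 32 / s = 1 / (2 * s) * d ^ 2 / 16 := by field_simp; ring
    linarith
  have h3 : w * d ≤ (z + d) / 2 * d := by gcongr
  have h4 : 0 ≤ P⁻¹ * z ^ 2 := by positivity
  nlinarith

lemma inv_gamma_density {a r s : ℝ} (hs : 0 < s) :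
    |(-1 : ℝ)| * s ^ ((-1 : ℝ) - 1) * ((s ^ (-1 : ℝ)) ^ (a - 1) * exp (-(r * s ^ (-1 : ℝ)))) =
      s ^ (-a - 1) * exp (-(r / s)) := by
  rw [← rpow_mul hs.le, abs_neg, abs_one, one_mul, ← mul_assoc, ← rpow_add hs, rpow_neg_one,
    ← div_eq_mul_inv]
  ring_nf

lemma integral_rpow_mul_exp_neg_div_Ioi {a r : ℝ} (ha : 0 < a) (hr : 0 < r) :
    ∫ s in Ioi (0 : ℝ), s ^ (-a - 1) * exp (-(r / s)) = (1 / r) ^ a * Gamma a := by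
  rw [← integral_rpow_mul_exp_neg_mul_Ioi ha hr,
    ← integral_comp_rpow_Ioi (fun y : ℝ => y ^ (a - 1) * exp (-(r * y)))
      (by norm_num : (-1 : ℝ) ≠ 0)]
  refine setIntegral_congr_fun measurableSet_Ioi fun s hs => ?_
  simpa only [smul_eq_mul] using (inv_gamma_density hs).symm

lemma integrableOn_rpow_mul_exp_neg_div_Ioi {a r : ℝ} (ha : 0 < a) (hr : 0 < r) :
    IntegrableOn (fun s : ℝ => s ^ (-a - 1) * exp (-(r / s))) (Ioi 0) := by
  refine Integrable.of_integral_ne_zero ?_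
  rw [integral_rpow_mul_exp_neg_div_Ioi ha hr]
  have := Gamma_pos_of_pos ha
  positivity

/-- Pointwise Poisson-type bound for the kernel `Q`. -/
lemma exists_abs_Q_le (n : ℕ) (hn : 1 ≤ n) (α : ℝ) (hα : -(n : ℝ) < α) :
    ∃ K > (0 : ℝ), ∀ x y : EuclideanSpace ℝ (Fin n), x ≠ y → ∀ t > (0 : ℝ),
      |Q n α t x y| ≤ K * exp (-(1 / 24) * (‖x - y‖ ^ 2 + ‖y‖ * ‖x - y‖)) * t *
        (1 / (‖x - y‖ ^ 2 / 32 + t ^ 2 / 8)) ^ (((n : ℝ) + 1) / 2) := by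
  obtain ⟨A, hA, hpre⟩ := exists_exp_mul_mehler_prefactor_le n hn α hα
  set a : ℝ := ((n : ℝ) + 1) / 2 with ha
  have ha0 : 0 < a := by positivity
  have hΓ := Gamma_pos_of_pos ha0
  refine ⟨4 * A * Gamma a, by positivity, fun x y hxy t ht => ?_⟩
  have hd : 0 < ‖x - y‖ := norm_pos_iff.2 (sub_ne_zero.2 hxy)
  have hw : ‖y‖ ≤ (‖x + y‖ + ‖x - y‖) / 2 := by
    have h := norm_sub_le (x + y) (x - y)
    have e : (x + y) - (x - y) = (2 : ℝ) • y := by rw [two_smul]; abel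
    rw [e, norm_smul, Real.norm_ofNat] at h
    linarith
  set E : ℝ := exp (-(1 / 24) * (‖x - y‖ ^ 2 + ‖y‖ * ‖x - y‖)) with hE
  set r : ℝ := ‖x - y‖ ^ 2 / 32 + t ^ 2 / 8 with hr
  have hr0 : 0 < r := by positivity
  have hbound : ∀ s ∈ Ioi (0 : ℝ), ‖s ^ (-(3 : ℝ) / 2) * (1 - t ^ 2 / (2 * s)) *
      exp (-t ^ 2 / (4 * s)) * exp (-α * s) * W n s x y‖ ≤
      4 * A * E * (s ^ (-a - 1) * exp (-(r / s))) := by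
    intro s hs
    have hs : 0 < s := hs
    set B := (exp (-2 * s) / (π * (1 - exp (-4 * s)))) ^ ((n : ℝ) / 2) with hB
    have hB0 : 0 ≤ B := by
      have : exp (-4 * s) < 1 := exp_lt_one_iff.2 (by linarith)
      exact rpow_nonneg (div_nonneg (exp_pos _).le (mul_nonneg pi_pos.le (by linarith))) _
    set v := t ^ 2 / (8 * s) with hv
    have hv0 : 0 ≤ v := by positivity
    have h4v : t ^ 2 / (2 * s) = 4 * v := by rw [hv]; field_simp; norm_num
    have h2v : -t ^ 2 / (4 * s) = -(2 * v) := by rw [hv]; field_simp; norm_num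
    have hφ : |1 - 4 * v| * exp (-(2 * v)) ≤ 4 * exp (-v) := by
      have h1 : |1 - 4 * v| ≤ 4 * exp v := by
        have := add_one_le_exp v
        rw [abs_le]; constructor <;> linarith
      calc |1 - 4 * v| * exp (-(2 * v)) ≤ 4 * exp v * exp (-(2 * v)) := by gcongr
        _ = 4 * exp (-v) := by rw [mul_assoc, ← exp_add]; ring_nf
    have hexp : exp (-(1 / 4) * ((1 + exp (-2 * s)) / (1 - exp (-2 * s)) * ‖x - y‖ ^ 2 +
        (1 - exp (-2 * s)) / (1 + exp (-2 * s)) * ‖x + y‖ ^ 2)) ≤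
        exp (-(‖x - y‖ ^ 2 / 32 / s)) * E := by
      rw [hE, ← exp_add]
      apply exp_le_exp.2
      linarith [mehler_exponent_ge hs (norm_nonneg (x - y)) hw]
    rw [h4v, h2v, W, ← hB]
    set V := exp (-(1 / 4) * ((1 + exp (-2 * s)) / (1 - exp (-2 * s)) * ‖x - y‖ ^ 2 +
        (1 - exp (-2 * s)) / (1 + exp (-2 * s)) * ‖x + y‖ ^ 2))
    have hV0 : 0 ≤ V := (exp_pos _).le
    simp only [abs_of_nonneg hV0, norm_mul, Real.norm_eq_abs, abs_exp, abs_of_nonneg hB0,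
      abs_of_pos (rpow_pos_of_pos hs _)]
    calc s ^ (-(3 : ℝ) / 2) * |1 - 4 * v| * exp (-(2 * v)) * exp (-α * s) * (B * V)
        = s ^ (-(3 : ℝ) / 2) * (|1 - 4 * v| * exp (-(2 * v))) * (exp (-α * s) * B) * V := by
          ring
      _ ≤ s ^ (-(3 : ℝ) / 2) * (4 * exp (-v)) * (A * s ^ (-(n : ℝ) / 2)) *
          (exp (-(‖x - y‖ ^ 2 / 32 / s)) * E) := by
          have hp := hpre s hs
          gcongr ?_ * ?_ * ?_ * ?_
      _ = 4 * A * E * ((s ^ (-(3 : ℝ) / 2) * s ^ (-(n : ℝ) / 2)) *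
          (exp (-(‖x - y‖ ^ 2 / 32 / s)) * exp (-v))) := by ring
      _ = _ := by
          rw [← rpow_add hs, ← exp_add]
          congr 3
          · rw [ha]; ring
          · rw [hr, hv]; field_simp; ring
  have hint : |∫ s in Ioi (0 : ℝ), s ^ (-(3 : ℝ) / 2) * (1 - t ^ 2 / (2 * s)) *
      exp (-t ^ 2 / (4 * s)) * exp (-α * s) * W n s x y| ≤
      4 * A * E * ((1 / r) ^ a * Gamma a) := by
    rw [← integral_rpow_mul_exp_neg_div_Ioi ha0 hr0, ← integral_const_mul]
    exact norm_integral_le_of_norm_le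
      ((integrableOn_rpow_mul_exp_neg_div_Ioi ha0 hr0).const_mul _)
      ((ae_restrict_iff' measurableSet_Ioi).2 (.of_forall hbound))
  have hsqrt : 1 ≤ √(4 * π) := one_le_sqrt.2 (by linarith [pi_gt_three])
  rw [Q, abs_mul, abs_of_nonneg (by positivity : 0 ≤ t / √(4 * π))]
  calc t / √(4 * π) * _ ≤ t * (4 * A * E * ((1 / r) ^ a * Gamma a)) := by
        gcongr
        exact div_le_self ht.le hsqrt
    _ = _ := by ring

lemma hasDerivAt_neg_inv_quadratic_pow {n : ℕ} (hn : 1 ≤ n) {b : ℝ} (hb : 0 < b) (t : ℝ) :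
    HasDerivAt (fun t : ℝ => -(4 / (n : ℝ)) * ((b + t ^ 2 / 8) ^ n)⁻¹)
      (t * (1 / (b + t ^ 2 / 8)) ^ (n + 1)) t := by
  have hr : 0 < b + t ^ 2 / 8 := by positivity
  have h := (((((hasDerivAt_id t).pow 2).div_const 8).const_add b).pow n).inv
    (pow_pos hr n).ne'
  have hn0 : (n : ℝ) ≠ 0 := by positivity
  refine (h.const_mul (-(4 / (n : ℝ)))).congr_deriv ?_
  obtain ⟨m, rfl⟩ : ∃ m, n = m + 1 := ⟨n - 1, by omega⟩
  simp only [id, Nat.add_sub_cancel, Pi.pow_apply, Nat.cast_ofNat, mul_one]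
  clear h
  generalize b + t ^ 2 / 8 = R at hr ⊢
  rw [div_pow, one_pow]
  field_simp
  ring

lemma tendsto_neg_inv_quadratic_pow {n : ℕ} (hn : 1 ≤ n) (b : ℝ) :
    Filter.Tendsto (fun t : ℝ => -(4 / (n : ℝ)) * ((b + t ^ 2 / 8) ^ n)⁻¹) Filter.atTop
      (nhds 0) := by
  have h1 : Filter.Tendsto (fun t : ℝ => b + t ^ 2 / 8) Filter.atTop Filter.atTop :=
    Filter.tendsto_atTop_add_const_left _ _
      ((Filter.tendsto_pow_atTop two_ne_zero).atTop_div_const (by norm_num))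
  have h2 := ((Filter.tendsto_pow_atTop (by omega : n ≠ 0)).comp h1).inv_tendsto_atTop
  simpa using h2.const_mul (-(4 / (n : ℝ)))

lemma integral_mul_inv_quadratic_pow {n : ℕ} (hn : 1 ≤ n) {b : ℝ} (hb : 0 < b) :
    IntegrableOn (fun t : ℝ => t * (1 / (b + t ^ 2 / 8)) ^ (n + 1)) (Ioi 0) ∧
      ∫ t in Ioi (0 : ℝ), t * (1 / (b + t ^ 2 / 8)) ^ (n + 1) = 4 / n * (b ^ n)⁻¹ := by
  have hd := fun t (_ : t ∈ Ici (0 : ℝ)) => hasDerivAt_neg_inv_quadratic_pow hn hb t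
  have hpos : ∀ t ∈ Ioi (0 : ℝ), 0 ≤ t * (1 / (b + t ^ 2 / 8)) ^ (n + 1) := by
    intro t ht
    have : 0 < t := ht
    positivity
  refine ⟨integrableOn_Ioi_deriv_of_nonneg' hd hpos (tendsto_neg_inv_quadratic_pow hn b), ?_⟩
  rw [integral_Ioi_of_hasDerivAt_of_nonneg' hd hpos (tendsto_neg_inv_quadratic_pow hn b)]
  simp

theorem Q_H_norm_bound (n : ℕ) (hn : 1 ≤ n) (α : ℝ) (hα : -(n : ℝ) < α) :
    ∃ C > (0 : ℝ), ∃ c > (0 : ℝ), ∀ x y : EuclideanSpace ℝ (Fin n), x ≠ y →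
      Real.sqrt (∫ t in Set.Ioi (0 : ℝ), Q n α t x y ^ 2 / t) ≤
        C * Real.exp (-c * (‖x - y‖ ^ 2 + ‖y‖ * ‖x - y‖)) / ‖x - y‖ ^ n := by
  obtain ⟨K, hK, hQ⟩ := exists_abs_Q_le n hn α hα
  refine ⟨K * 2 * 32 ^ n, by positivity, 1 / 24, by norm_num, fun x y hxy => ?_⟩
  have hd : 0 < ‖x - y‖ := norm_pos_iff.2 (sub_ne_zero.2 hxy)
  have hQ := hQ x y hxy
  set E : ℝ := exp (-(1 / 24) * (‖x - y‖ ^ 2 + ‖y‖ * ‖x - y‖))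
  have hE : 0 < E := exp_pos _
  generalize ‖x - y‖ = d at *
  obtain ⟨hint, hval⟩ := integral_mul_inv_quadratic_pow hn (b := d ^ 2 / 32) (by positivity)
  have hle : ∫ t in Ioi (0 : ℝ), Q n α t x y ^ 2 / t ≤
      (K * E) ^ 2 * (4 / n * ((d ^ 2 / 32) ^ n)⁻¹) := by
    rw [← hval, ← integral_const_mul]
    refine integral_mono_of_nonneg ?_ (hint.const_mul _) ?_
    · refine (ae_restrict_iff' measurableSet_Ioi).2 (.of_forall fun t ht => ?_)
      exact div_nonneg (sq_nonneg _) (le_of_lt ht)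
    · refine (ae_restrict_iff' measurableSet_Ioi).2 (.of_forall fun t ht => ?_)
      have ht : 0 < t := ht
      have hr : 0 < 1 / (d ^ 2 / 32 + t ^ 2 / 8) := by positivity
      have hpow : ((1 / (d ^ 2 / 32 + t ^ 2 / 8)) ^ (((n : ℝ) + 1) / 2)) ^ 2 =
          (1 / (d ^ 2 / 32 + t ^ 2 / 8)) ^ (n + 1) := by
        rw [← rpow_natCast _ 2, ← rpow_mul hr.le, ← rpow_natCast _ (n + 1)]
        congr 1
        push_cast
        ring
      show Q n α t x y ^ 2 / t ≤ _
      rw [div_le_iff₀ ht, ← sq_abs]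
      calc |Q n α t x y| ^ 2 ≤ _ := pow_le_pow_left₀ (abs_nonneg _) (hQ t ht) 2
        _ = (K * E) ^ 2 * (t * (1 / (d ^ 2 / 32 + t ^ 2 / 8)) ^ (n + 1)) * t := by
          rw [mul_pow, hpow]; ring
  refine sqrt_le_iff.2 ⟨by positivity, hle.trans ?_⟩
  have hn1 : (1 : ℝ) ≤ n := by exact_mod_cast hn
  have h32 : (32 : ℝ) ^ n ≤ (32 ^ n) ^ 2 := le_self_pow₀ (one_le_pow₀ (by norm_num)) two_ne_zero
  calc (K * E) ^ 2 * (4 / n * ((d ^ 2 / 32) ^ n)⁻¹)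
      ≤ (K * E) ^ 2 * (4 * ((d ^ 2 / 32) ^ n)⁻¹) := by
        gcongr
        exact div_le_self (by norm_num) hn1
    _ = (K * E) ^ 2 * 4 * 32 ^ n / (d ^ n) ^ 2 := by
        rw [div_pow, inv_div, ← pow_mul, ← pow_mul, mul_comm n 2]; ring
    _ ≤ (K * E) ^ 2 * 4 * (32 ^ n) ^ 2 / (d ^ n) ^ 2 := by gcongr
    _ = _ := by ring
end

section
/- Let n ≥ 1. For every ℓ ∈ ℕ there exists a constant C > 0 such that for all x, y ∈ ℝⁿ with x ≠ y and all t > 0, P_t^L(x,y) ≤ C (1 + |x-y|/ρ(x))^{-ℓ} |x-y|^{-n}. -/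
open Real MeasureTheory Set

/-- The Hermite-Poisson kernel. -/
noncomputable def P (n : ℕ) (t : ℝ) (x y : EuclideanSpace ℝ (Fin n)) : ℝ :=
  t / Real.sqrt (4 * Real.pi) *
    ∫ s in Set.Ioi (0 : ℝ), s ^ (-(3 : ℝ) / 2) * Real.exp (-t ^ 2 / (4 * s)) * W n s x y

/-- The critical radius function ρ for the Hermite operator. -/
noncomputable def rho (n : ℕ) (x : EuclideanSpace ℝ (Fin n)) : ℝ :=
  if 1 ≤ ‖x‖ then 1 / (1 + ‖x‖) else 1 / 2

/-- The density of the subordination formula, as the pullback of a Gaussian under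
`s ↦ s ^ (-1 / 2)`. -/
lemma subordination_density_eq (t : ℝ) {s : ℝ} (hs : 0 < s) :
    s ^ (-(3 : ℝ) / 2) * exp (-t ^ 2 / (4 * s)) =
      2 * ((|(-(1 / 2) : ℝ)| * s ^ ((-(1 / 2) : ℝ) - 1)) •
        exp (-(t ^ 2 / 4) * (s ^ (-(1 / 2) : ℝ)) ^ 2)) := by
  have hsq : (s ^ (-(1 / 2) : ℝ)) ^ 2 = s⁻¹ := by
    rw [← rpow_natCast, ← rpow_mul hs.le, ← rpow_neg_one]
    norm_num
  have habs : |(-(1 / 2) : ℝ)| = 1 / 2 := by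
    rw [abs_neg, abs_of_pos (by norm_num)]
  have hexp : (-(1 / 2) : ℝ) - 1 = -(3 : ℝ) / 2 := by norm_num
  have harg : -t ^ 2 / (4 * s) = -(t ^ 2 / 4) * s⁻¹ := by
    field_simp
  rw [hsq, habs, hexp, harg, smul_eq_mul]
  ring

lemma integrableOn_subordination_density {t : ℝ} (ht : 0 < t) :
    IntegrableOn (fun s : ℝ => s ^ (-(3 : ℝ) / 2) * exp (-t ^ 2 / (4 * s))) (Ioi 0) := by
  have hgauss : IntegrableOn (fun v : ℝ => exp (-(t ^ 2 / 4) * v ^ 2)) (Ioi 0) :=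
    (integrable_exp_neg_mul_sq (by positivity)).integrableOn
  have hpull := ((integrableOn_Ioi_comp_rpow_iff _
    (by norm_num : (-(1 / 2) : ℝ) ≠ 0)).2 hgauss).const_mul 2
  exact IntegrableOn.congr_fun hpull
    (fun s hs => (subordination_density_eq t hs).symm) measurableSet_Ioi

lemma integral_subordination_density {t : ℝ} (ht : 0 < t) :
    ∫ s in Ioi (0 : ℝ), s ^ (-(3 : ℝ) / 2) * exp (-t ^ 2 / (4 * s)) = √(4 * π) / t := by
  rw [setIntegral_congr_fun measurableSet_Ioi (fun s hs => subordination_density_eq t hs),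
    integral_const_mul,
    integral_comp_rpow_Ioi (fun v : ℝ => exp (-(t ^ 2 / 4) * v ^ 2)) (by norm_num),
    integral_gaussian_Ioi]
  have h : π / (t ^ 2 / 4) = 4 * π / t ^ 2 := by
    field_simp
  rw [h, sqrt_div (by positivity), sqrt_sq ht.le]
  ring

lemma one_add_pow_le_mul_exp (m : ℕ) {u : ℝ} (hu : 0 ≤ u) :
    (1 + u) ^ m ≤ 4 ^ m * m.factorial * exp (1 / 4) * exp (u / 4) := by
  have h := pow_div_factorial_le_exp ((1 + u) / 4) (by positivity) m
  rw [add_div, exp_add, ← add_div, div_pow, div_div, div_le_iff₀ (by positivity)] at h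
  linarith

lemma one_add_norm_div_rho_le (n : ℕ) (x y : EuclideanSpace ℝ (Fin n)) {a : ℝ} (ha : 1 ≤ a) :
    1 + ‖x - y‖ / rho n x ≤ 3 * (1 + (a * ‖x - y‖ ^ 2 + a⁻¹ * ‖x + y‖ ^ 2)) := by
  have ha0 : 0 < a := by linarith
  have hx : 2 * ‖x‖ ≤ ‖x - y‖ + ‖x + y‖ := by
    have h := norm_add_le (x - y) (x + y)
    rwa [show x - y + (x + y) = (2 : ℝ) • x by rw [two_smul]; abel, norm_smul,
      Real.norm_ofNat] at h
  have hd := norm_nonneg (x - y)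
  have hrho : ‖x - y‖ / rho n x ≤ ‖x - y‖ * (2 + ‖x‖) := by
    rw [div_eq_mul_inv]
    refine mul_le_mul_of_nonneg_left ?_ hd
    unfold rho
    split_ifs <;> simp
  have hcross : 2 * (‖x - y‖ * ‖x + y‖) ≤ a * ‖x - y‖ ^ 2 + a⁻¹ * ‖x + y‖ ^ 2 := by
    have h : a * ‖x - y‖ ^ 2 + a⁻¹ * ‖x + y‖ ^ 2 - 2 * (‖x - y‖ * ‖x + y‖) =
        a⁻¹ * (a * ‖x - y‖ - ‖x + y‖) ^ 2 := by
      field_simp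
      ring
    have : 0 ≤ a⁻¹ * (a * ‖x - y‖ - ‖x + y‖) ^ 2 := by positivity
    linarith
  have hsq : ‖x - y‖ ^ 2 ≤ a * ‖x - y‖ ^ 2 := le_mul_of_one_le_left (by positivity) ha
  have hinv : 0 ≤ a⁻¹ * ‖x + y‖ ^ 2 := by positivity
  have hmul := mul_le_mul_of_nonneg_left hx hd
  nlinarith [sq_nonneg (‖x - y‖ - 1)]

/-- A bound for the Mehler kernel in terms of `a = coth s`. -/
lemma W_le_pow_mul_exp (n : ℕ) {s : ℝ} (hs : 0 < s) (x y : EuclideanSpace ℝ (Fin n)) :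
    ∃ a : ℝ, 1 ≤ a ∧
      W n s x y ≤ √a ^ n * exp (-((a * ‖x - y‖ ^ 2 + a⁻¹ * ‖x + y‖ ^ 2) / 4)) := by
  have hr0 : 0 < exp (-2 * s) := exp_pos _
  have hr1 : exp (-2 * s) < 1 := exp_lt_one_iff.2 (by linarith)
  have hr2 : exp (-4 * s) = exp (-2 * s) ^ 2 := by
    rw [← exp_nat_mul]
    ring_nf
  unfold W
  rw [hr2]
  generalize exp (-2 * s) = r at hr0 hr1
  have h1 : 0 < 1 - r := by linarith
  have h2 : 0 < 1 - r ^ 2 := by nlinarith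
  refine ⟨(1 + r) / (1 - r), (one_le_div h1).2 (by linarith), ?_⟩
  rw [inv_div, show ∀ z : ℝ, -(1 / 4) * z = -(z / 4) by intro z; ring]
  gcongr
  rw [sqrt_eq_rpow, ← rpow_mul_natCast (by positivity), one_div_mul_eq_div]
  refine rpow_le_rpow (by positivity) ?_ (by positivity)
  rw [div_le_div_iff₀ (by positivity) h1]
  have hpi : 1 ≤ π := by linarith [pi_gt_three]
  calc r * (1 - r) ≤ (1 + r) * (1 - r ^ 2) := by nlinarith [mul_pos hr0 h1, mul_pos hr0 h2]
    _ ≤ (1 + r) * (π * (1 - r ^ 2)) := by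
      gcongr
      exact le_mul_of_one_le_left h2.le hpi

/-- The Mehler kernel satisfies the claimed bound uniformly in time. -/
lemma W_rho_bound (n ℓ : ℕ) {s : ℝ} (hs : 0 < s) {x y : EuclideanSpace ℝ (Fin n)}
    (hxy : x ≠ y) :
    W n s x y ≤ 3 ^ ℓ * (4 ^ (ℓ + n) * (ℓ + n).factorial * exp (1 / 4)) /
      ((1 + ‖x - y‖ / rho n x) ^ ℓ * ‖x - y‖ ^ n) := by
  obtain ⟨a, ha, hW⟩ := W_le_pow_mul_exp n hs x y
  have ha0 : 0 < a := by linarith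
  have hd : 0 < ‖x - y‖ := norm_pos_iff.2 (sub_ne_zero.2 hxy)
  have hrho : 0 < rho n x := by
    unfold rho
    split_ifs <;> positivity
  have hR := one_add_norm_div_rho_le n x y ha
  have hA : ‖x - y‖ * √a ≤ 1 + (a * ‖x - y‖ ^ 2 + a⁻¹ * ‖x + y‖ ^ 2) := by
    have hinv : 0 ≤ a⁻¹ * ‖x + y‖ ^ 2 := by positivity
    have hsq : (‖x - y‖ * √a) ^ 2 = a * ‖x - y‖ ^ 2 := by
      rw [mul_pow, sq_sqrt ha0.le, mul_comm]
    nlinarith [sq_nonneg (‖x - y‖ * √a - 1)]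
  have hu : 0 ≤ a * ‖x - y‖ ^ 2 + a⁻¹ * ‖x + y‖ ^ 2 := by positivity
  generalize a * ‖x - y‖ ^ 2 + a⁻¹ * ‖x + y‖ ^ 2 = u at hW hR hA hu
  rw [le_div_iff₀ (by positivity)]
  calc W n s x y * ((1 + ‖x - y‖ / rho n x) ^ ℓ * ‖x - y‖ ^ n)
      ≤ √a ^ n * exp (-(u / 4)) * ((1 + ‖x - y‖ / rho n x) ^ ℓ * ‖x - y‖ ^ n) := by gcongr
    _ = (1 + ‖x - y‖ / rho n x) ^ ℓ * (‖x - y‖ * √a) ^ n * exp (-(u / 4)) := by ring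
    _ ≤ (3 * (1 + u)) ^ ℓ * (1 + u) ^ n * exp (-(u / 4)) := by gcongr
    _ = 3 ^ ℓ * (1 + u) ^ (ℓ + n) * exp (-(u / 4)) := by
      rw [mul_pow, pow_add, mul_assoc (3 ^ ℓ)]
    _ ≤ 3 ^ ℓ * (4 ^ (ℓ + n) * (ℓ + n).factorial * exp (1 / 4) * exp (u / 4)) *
        exp (-(u / 4)) := by
      gcongr
      exact one_add_pow_le_mul_exp _ hu
    _ = 3 ^ ℓ * (4 ^ (ℓ + n) * (ℓ + n).factorial * exp (1 / 4)) := by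
      rw [exp_neg]
      field_simp

lemma W_nonneg (n : ℕ) {s : ℝ} (hs : 0 < s) (x y : EuclideanSpace ℝ (Fin n)) :
    0 ≤ W n s x y := by
  have h : 0 < 1 - exp (-4 * s) := sub_pos.2 (exp_lt_one_iff.2 (by linarith))
  unfold W
  positivity

/-- The Poisson kernel is an average of the Mehler kernels. -/
lemma P_le_of_W_le (n : ℕ) {x y : EuclideanSpace ℝ (Fin n)} {B : ℝ}
    (hB : ∀ s, 0 < s → W n s x y ≤ B) {t : ℝ} (ht : 0 < t) : P n t x y ≤ B := by
  have hle : ∫ s in Ioi (0 : ℝ), s ^ (-(3 : ℝ) / 2) * exp (-t ^ 2 / (4 * s)) * W n s x y ≤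
      ∫ s in Ioi (0 : ℝ), s ^ (-(3 : ℝ) / 2) * exp (-t ^ 2 / (4 * s)) * B := by
    refine integral_mono_of_nonneg ?_ ((integrableOn_subordination_density ht).mul_const B) ?_
    · filter_upwards [ae_restrict_mem measurableSet_Ioi] with s hs
      have hs : 0 < s := hs
      exact mul_nonneg (by positivity) (W_nonneg n hs x y)
    · filter_upwards [ae_restrict_mem measurableSet_Ioi] with s hs
      have hs : 0 < s := hs
      exact mul_le_mul_of_nonneg_left (hB s hs) (by positivity)
  rw [integral_mul_const, integral_subordination_density ht] at hle
  calc P n t x y ≤ t / √(4 * π) * (√(4 * π) / t * B) :=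
        mul_le_mul_of_nonneg_left hle (by positivity)
    _ = B := by field_simp

theorem poisson_kernel_rho_bound (n : ℕ) (hn : 1 ≤ n) (ℓ : ℕ) :
    ∃ C > (0 : ℝ), ∀ x y : EuclideanSpace ℝ (Fin n), x ≠ y → ∀ t : ℝ, 0 < t →
      P n t x y ≤ C / ((1 + ‖x - y‖ / rho n x) ^ ℓ * ‖x - y‖ ^ n) :=
  ⟨3 ^ ℓ * (4 ^ (ℓ + n) * (ℓ + n).factorial * exp (1 / 4)), by positivity,
    fun _ _ hxy _ ht => P_le_of_W_le n (fun _ hs => W_rho_bound n ℓ hs hxy) ht⟩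
end

section
/- Let n ≥ 1, α > -n and j ∈ {1,…,n}. There exists a constant C > 0 such that for all x, y ∈ ℝⁿ and all s, t > 0, |Ω_{α,j}(x,y;s,t)| ≤ C t/(s+t+|x-y|)^{n+2}. -/
open Real MeasureTheory Set

/-- V_{j,s}(x,y) = ∂_{x_j} W_s(x,y). -/
noncomputable def V (n : ℕ) (j : Fin n) (s : ℝ) (x y : EuclideanSpace ℝ (Fin n)) : ℝ :=
  -(1 / 2) * ((1 + Real.exp (-2 * s)) / (1 - Real.exp (-2 * s)) * (x j - y j) +
    (1 - Real.exp (-2 * s)) / (1 + Real.exp (-2 * s)) * (x j + y j)) * W n s x y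

/-- Ω_{α,j}(x,y;s,t) = ∂_{x_j}[t ∂_t P_{t+s}^α(x,y)]. -/
noncomputable def Omj (n : ℕ) (α : ℝ) (j : Fin n) (x y : EuclideanSpace ℝ (Fin n)) (s t : ℝ) : ℝ :=
  t / Real.sqrt (4 * Real.pi) *
    ∫ u in Set.Ioi (0 : ℝ), u ^ (-(3 : ℝ) / 2) * (1 - (t + s) ^ 2 / (2 * u)) *
      Real.exp (-(t + s) ^ 2 / (4 * u)) * Real.exp (-α * u) * V n j u x y

/-- A power of an affine function is dominated by any growing exponential. -/
theorem exists_one_add_rpow_le_exp {p β : ℝ} (hp : 0 < p) (hβ : 0 < β) :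
    ∃ K > (0 : ℝ), ∀ u : ℝ, 0 < u → (1 + 4 * u) ^ p ≤ K * Real.exp (β * u) := by
  have hc : 0 < β / p := div_pos hβ hp
  set K := 1 + 4 / (β / p) with hK
  have hK0 : 0 < K := by positivity
  refine ⟨K ^ p, Real.rpow_pos_of_pos hK0 p, fun u hu => ?_⟩
  have h1 : 1 + 4 * u ≤ K * Real.exp (β / p * u) := by
    have h2 : β / p * u + 1 ≤ Real.exp (β / p * u) := Real.add_one_le_exp _
    have h3 : K * (β / p * u + 1) = 1 + 4 * u + (β / p * u + 4 / (β / p)) := by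
      rw [hK]; field_simp; ring
    have h4 : 0 ≤ β / p * u + 4 / (β / p) := by positivity
    have h5 := mul_le_mul_of_nonneg_left h2 hK0.le
    linarith
  calc (1 + 4 * u) ^ p ≤ (K * Real.exp (β / p * u)) ^ p :=
        Real.rpow_le_rpow (by positivity) h1 hp.le
    _ = K ^ p * Real.exp (β * u) := by
        rw [Real.mul_rpow hK0.le (Real.exp_pos _).le, ← Real.exp_mul]
        congr 2
        field_simp

theorem one_sub_exp_neg_ge {a : ℝ} (ha : 0 < a) : a / (1 + a) ≤ 1 - Real.exp (-a) := by
  have h1 : a + 1 ≤ Real.exp a := Real.add_one_le_exp a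
  have h2 : Real.exp (-a) ≤ 1 / (1 + a) := by
    rw [Real.exp_neg, ← one_div]
    exact one_div_le_one_div_of_le (by positivity) (by linarith)
  have h3 : a / (1 + a) = 1 - 1 / (1 + a) := by field_simp; ring
  linarith

theorem one_sub_exp_neg_two_mul_pos {u : ℝ} (hu : 0 < u) : 0 < 1 - Real.exp (-2 * u) := by
  have : Real.exp (-2 * u) < 1 := Real.exp_lt_one_iff.mpr (by linarith)
  linarith

/-- The hyperbolic cotangent, as it appears in the Mehler kernel, is at most `(1 + 4u)/u`. -/
theorem coth_le {u : ℝ} (hu : 0 < u) :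
    (1 + Real.exp (-2 * u)) / (1 - Real.exp (-2 * u)) ≤ (1 + 4 * u) / u := by
  have h1 := one_sub_exp_neg_ge (a := 2 * u) (by positivity)
  have h2 : Real.exp (-2 * u) < 1 := Real.exp_lt_one_iff.mpr (by linarith)
  rw [show -(2 * u) = -2 * u by ring, div_le_iff₀ (by positivity)] at h1
  rw [div_le_div_iff₀ (one_sub_exp_neg_two_mul_pos hu) hu]
  nlinarith [mul_pos hu (one_sub_exp_neg_two_mul_pos hu), mul_lt_mul_of_pos_left h2 hu]

/-- The hyperbolic cotangent, as it appears in the Mehler kernel, is at least `1/(2u)`. -/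
theorem le_coth {u : ℝ} (hu : 0 < u) :
    1 / (2 * u) ≤ (1 + Real.exp (-2 * u)) / (1 - Real.exp (-2 * u)) := by
  have h1 : -2 * u + 1 ≤ Real.exp (-2 * u) := Real.add_one_le_exp _
  rw [div_le_div_iff₀ (by positivity) (one_sub_exp_neg_two_mul_pos hu)]
  nlinarith [mul_pos hu (Real.exp_pos (-2 * u))]

theorem mehler_prefactor_le_s11 {u : ℝ} (hu : 0 < u) :
    Real.exp (-2 * u) / (Real.pi * (1 - Real.exp (-4 * u))) ≤
      Real.exp (-2 * u) * ((1 + 4 * u) / u) := by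
  have h1 := one_sub_exp_neg_ge (a := 4 * u) (by positivity)
  rw [show -(4 * u) = -4 * u by ring] at h1
  have h2 : u / (1 + 4 * u) ≤ Real.pi * (1 - Real.exp (-4 * u)) := by
    have h3 : u / (1 + 4 * u) ≤ 4 * u / (1 + 4 * u) := by gcongr; linarith
    have h4 : 0 ≤ 4 * u / (1 + 4 * u) := by positivity
    nlinarith [Real.pi_gt_three]
  rw [div_eq_mul_inv]
  gcongr
  rw [← inv_div]
  exact inv_anti₀ (by positivity) h2

/-- The space-independent part of the kernel bound. -/
theorem exists_time_factor_le (n : ℕ) {α : ℝ} (hα : -(n : ℝ) < α) :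
    ∃ K > (0 : ℝ), ∀ u : ℝ, 0 < u →
      √((1 + Real.exp (-2 * u)) / (1 - Real.exp (-2 * u))) *
        (Real.exp (-2 * u) / (Real.pi * (1 - Real.exp (-4 * u)))) ^ ((n : ℝ) / 2) *
        Real.exp (-α * u) ≤ K * u ^ (-((n : ℝ) + 1) / 2) := by
  obtain ⟨K, hK, h⟩ := exists_one_add_rpow_le_exp (p := ((n : ℝ) + 1) / 2) (β := n + α)
    (by positivity) (by linarith)
  refine ⟨K, hK, fun u hu => ?_⟩
  have hb : (0 : ℝ) < (1 + 4 * u) / u := by positivity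
  have h4 : 0 ≤ Real.exp (-2 * u) / (Real.pi * (1 - Real.exp (-4 * u))) := by
    have : Real.exp (-4 * u) < 1 := Real.exp_lt_one_iff.mpr (by linarith)
    have : 0 < 1 - Real.exp (-4 * u) := by linarith
    positivity
  calc _ ≤ √((1 + 4 * u) / u) * (Real.exp (-2 * u) * ((1 + 4 * u) / u)) ^ ((n : ℝ) / 2) *
        Real.exp (-α * u) := by
        have hA := Real.sqrt_le_sqrt (coth_le hu)
        have hP := Real.rpow_le_rpow h4 (mehler_prefactor_le_s11 hu)
          (by positivity : (0 : ℝ) ≤ (n : ℝ) / 2)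
        exact mul_le_mul_of_nonneg_right
          (mul_le_mul hA hP (Real.rpow_nonneg h4 _) (Real.sqrt_nonneg _)) (Real.exp_pos _).le
    _ = u ^ (-((n : ℝ) + 1) / 2) * (1 + 4 * u) ^ (((n : ℝ) + 1) / 2) *
        Real.exp (-((n + α) * u)) := by
        rw [Real.mul_rpow (Real.exp_pos _).le hb.le, ← Real.exp_mul, Real.sqrt_eq_rpow]
        have e1 : u ^ (-((n : ℝ) + 1) / 2) * (1 + 4 * u) ^ (((n : ℝ) + 1) / 2) =
            ((1 + 4 * u) / u) ^ (1 / 2 : ℝ) * ((1 + 4 * u) / u) ^ ((n : ℝ) / 2) := by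
          rw [← Real.rpow_add hb, show (1 / 2 + (n : ℝ) / 2) = ((n : ℝ) + 1) / 2 by ring,
            Real.div_rpow (by positivity) hu.le,
            show -((n : ℝ) + 1) / 2 = -(((n : ℝ) + 1) / 2) by ring, Real.rpow_neg hu.le]
          ring
        have e2 : Real.exp (-((n + α) * u)) =
            Real.exp (-2 * u * ((n : ℝ) / 2)) * Real.exp (-α * u) := by
          rw [← Real.exp_add]; congr 1; ring
        rw [e1, e2]; ring
    _ ≤ u ^ (-((n : ℝ) + 1) / 2) * (K * Real.exp ((n + α) * u)) *
        Real.exp (-((n + α) * u)) := by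
        gcongr
        exact h u hu
    _ = K * u ^ (-((n : ℝ) + 1) / 2) := by
        rw [Real.exp_neg]; field_simp

theorem mul_exp_neg_sq_le (z : ℝ) : z * Real.exp (-(z ^ 2 / 8)) ≤ 2 := by
  rw [Real.exp_neg, ← div_eq_mul_inv, div_le_iff₀ (Real.exp_pos _)]
  nlinarith [Real.add_one_le_exp (z ^ 2 / 8), sq_nonneg (z - 2)]

theorem mul_mul_exp_neg_le {a : ℝ} (ha : 0 ≤ a) (d : ℝ) :
    a * d * Real.exp (-(a * d ^ 2 / 8)) ≤ 2 * √a := by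
  have h := mul_exp_neg_sq_le (√a * d)
  rw [mul_pow, Real.sq_sqrt ha] at h
  have h2 := mul_le_mul_of_nonneg_left h (Real.sqrt_nonneg a)
  have h3 : √a * √a = a := Real.mul_self_sqrt ha
  calc a * d * Real.exp (-(a * d ^ 2 / 8))
      = √a * √a * d * Real.exp (-(a * d ^ 2 / 8)) := by rw [h3]
    _ ≤ _ := by linarith

theorem abs_one_sub_mul_exp_neg_le {w : ℝ} (hw : 0 ≤ w) :
    |1 - 4 * w| * Real.exp (-(2 * w)) ≤ 4 * Real.exp (-w) := by
  have h1 : |1 - 4 * w| ≤ 4 * Real.exp w := by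
    have := Real.add_one_le_exp w
    rw [abs_le]; constructor <;> linarith
  calc _ ≤ 4 * Real.exp w * Real.exp (-(2 * w)) := by gcongr
    _ = 4 * Real.exp (-w) := by
      rw [mul_assoc, ← Real.exp_add]; congr 2; ring

/-- Gaussian bound for the derivative of the Mehler kernel. -/
theorem abs_V_le (n : ℕ) (j : Fin n) {u : ℝ} (hu : 0 < u) (x y : EuclideanSpace ℝ (Fin n)) :
    |V n j u x y| ≤ 2 * (√((1 + Real.exp (-2 * u)) / (1 - Real.exp (-2 * u))) *
        (Real.exp (-2 * u) / (Real.pi * (1 - Real.exp (-4 * u)))) ^ ((n : ℝ) / 2)) *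
        Real.exp (-(‖x - y‖ ^ 2 / (16 * u))) := by
  have hq := one_sub_exp_neg_two_mul_pos hu
  have hA1 := le_coth hu
  have hBA : (1 - Real.exp (-2 * u)) / (1 + Real.exp (-2 * u)) ≤
      (1 + Real.exp (-2 * u)) / (1 - Real.exp (-2 * u)) := by
    have hB : (1 - Real.exp (-2 * u)) / (1 + Real.exp (-2 * u)) ≤ 1 := by
      rw [div_le_one (by positivity)]; linarith [Real.exp_pos (-2 * u)]
    have hA : 1 ≤ (1 + Real.exp (-2 * u)) / (1 - Real.exp (-2 * u)) := by
      rw [one_le_div hq]; linarith [Real.exp_pos (-2 * u)]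
    exact hB.trans hA
  have hB0 : 0 ≤ (1 - Real.exp (-2 * u)) / (1 + Real.exp (-2 * u)) := by positivity
  have hP0 : 0 ≤ (Real.exp (-2 * u) / (Real.pi * (1 - Real.exp (-4 * u)))) ^ ((n : ℝ) / 2) := by
    have : Real.exp (-4 * u) < 1 := Real.exp_lt_one_iff.mpr (by linarith)
    have : 0 < 1 - Real.exp (-4 * u) := by linarith
    positivity
  unfold V W
  set A := (1 + Real.exp (-2 * u)) / (1 - Real.exp (-2 * u))
  set B := (1 - Real.exp (-2 * u)) / (1 + Real.exp (-2 * u))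
  set P := (Real.exp (-2 * u) / (Real.pi * (1 - Real.exp (-4 * u)))) ^ ((n : ℝ) / 2)
  have hA0 : 0 ≤ A := hB0.trans hBA
  set d := ‖x - y‖
  set m := ‖x + y‖
  have hd : |x j - y j| ≤ d := by simpa using PiLp.norm_apply_le (x - y) j
  have hm : |x j + y j| ≤ m := by simpa using PiLp.norm_apply_le (x + y) j
  have hlin : |A * (x j - y j) + B * (x j + y j)| ≤ A * d + B * m := by
    refine (abs_add_le _ _).trans ?_
    rw [abs_mul, abs_mul, abs_of_nonneg hA0, abs_of_nonneg hB0]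
    gcongr
  have hexp : Real.exp (-(1 / 4) * (A * d ^ 2 + B * m ^ 2)) =
      Real.exp (-(A * d ^ 2 / 8)) * Real.exp (-(A * d ^ 2 / 8)) *
        (Real.exp (-(B * m ^ 2 / 8)) * Real.exp (-(B * m ^ 2 / 8))) := by
    simp only [← Real.exp_add]; congr 1; ring
  have hdu : Real.exp (-(A * d ^ 2 / 8)) ≤ Real.exp (-(d ^ 2 / (16 * u))) := by
    apply Real.exp_le_exp.mpr
    have h := mul_le_mul_of_nonneg_right hA1 (sq_nonneg d)
    have e : d ^ 2 / (16 * u) = 1 / (2 * u) * d ^ 2 / 8 := by field_simp; ring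
    rw [e]; linarith
  have h1 := mul_mul_exp_neg_le hA0 d
  have h2 := mul_mul_exp_neg_le hB0 m
  have h3 : √B ≤ √A := Real.sqrt_le_sqrt hBA
  have hE1 : Real.exp (-(A * d ^ 2 / 8)) ≤ 1 := Real.exp_le_one_iff.mpr (by
    have : 0 ≤ A * d ^ 2 / 8 := by positivity
    linarith)
  have hE2 : Real.exp (-(B * m ^ 2 / 8)) ≤ 1 := Real.exp_le_one_iff.mpr (by
    have : 0 ≤ B * m ^ 2 / 8 := by positivity
    linarith)
  rw [hexp]
  set E := Real.exp (-(A * d ^ 2 / 8)) with hE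
  set F := Real.exp (-(B * m ^ 2 / 8)) with hF
  have hE0 : 0 < E := Real.exp_pos _
  have hF0 : 0 < F := Real.exp_pos _
  have hmain : (A * d + B * m) * (E * E * (F * F)) ≤ 4 * √A * E := by
    have t1 : A * d * E * (F * F) ≤ 2 * √A :=
      (mul_le_of_le_one_right (by positivity) (mul_le_one₀ hE2 hF0.le hE2)).trans h1
    have t2 : B * m * F * (E * F) ≤ 2 * √A := by
      refine (mul_le_of_le_one_right (by positivity) (mul_le_one₀ hE1 hF0.le hE2)).trans ?_
      linarith
    have t3 := mul_le_mul_of_nonneg_right t1 hE0.le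
    have t4 := mul_le_mul_of_nonneg_right t2 hE0.le
    linarith
  calc _ = 1 / 2 * P * (|A * (x j - y j) + B * (x j + y j)| * (E * E * (F * F))) := by
        rw [abs_mul, abs_mul, abs_mul P, abs_of_nonneg hP0,
          abs_of_nonneg (by positivity : 0 ≤ E * E * (F * F))]
        norm_num
        ring
    _ ≤ 1 / 2 * P * (4 * √A * Real.exp (-(d ^ 2 / (16 * u)))) := by
        refine mul_le_mul_of_nonneg_left ?_ (by positivity)
        refine (mul_le_mul_of_nonneg_right hlin (by positivity)).trans (hmain.trans ?_)
        gcongr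
    _ = _ := by ring

/-- The inverse-Gamma integral, obtained from the Gamma integral by inverting the variable. -/
theorem integrableOn_and_integral_inverse_gamma {a R : ℝ} (ha : 0 < a) (hR : 0 < R) :
    IntegrableOn (fun u : ℝ => u ^ (-(a + 1)) * Real.exp (-(R / u))) (Ioi 0) ∧
      ∫ u in Ioi (0 : ℝ), u ^ (-(a + 1)) * Real.exp (-(R / u)) = (1 / R) ^ a * Real.Gamma a := by
  have hpt : ∀ u ∈ Ioi (0 : ℝ), (|(-1 : ℝ)| * u ^ ((-1 : ℝ) - 1)) •
      ((u ^ (-1 : ℝ)) ^ (a - 1) * Real.exp (-(R * u ^ (-1 : ℝ)))) =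
      u ^ (-(a + 1)) * Real.exp (-(R / u)) := by
    intro u hu
    have hu : 0 < u := hu
    rw [← Real.rpow_mul hu.le, smul_eq_mul, abs_neg, abs_one, one_mul, ← mul_assoc,
      ← Real.rpow_add hu, Real.rpow_neg_one, ← div_eq_mul_inv]
    congr 2
    ring
  have hint : IntegrableOn (fun v : ℝ => v ^ (a - 1) * Real.exp (-(R * v))) (Ioi 0) := by
    have := integrableOn_rpow_mul_exp_neg_mul_rpow (p := 1) (s := a - 1) (b := R)
      (by linarith) (by norm_num) hR
    simpa using this
  constructor
  · have := (integrableOn_Ioi_comp_rpow_iff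
      (fun v : ℝ => v ^ (a - 1) * Real.exp (-(R * v))) (p := -1) (by norm_num)).mpr hint
    exact this.congr_fun hpt measurableSet_Ioi
  · rw [← Real.integral_rpow_mul_exp_neg_mul_Ioi ha hR,
      ← integral_comp_rpow_Ioi (fun v : ℝ => v ^ (a - 1) * Real.exp (-(R * v))) (p := -1)
        (by norm_num)]
    exact (setIntegral_congr_fun measurableSet_Ioi hpt).symm

theorem Omj_bound (n : ℕ) (hn : 1 ≤ n) (α : ℝ) (hα : -(n : ℝ) < α) (j : Fin n) :
    ∃ C > (0 : ℝ), ∀ (x y : EuclideanSpace ℝ (Fin n)) (s t : ℝ), 0 < s → 0 < t →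
      |Omj n α j x y s t| ≤ C * t / (s + t + ‖x - y‖) ^ (n + 2) := by
  obtain ⟨K, hK, hKu⟩ := exists_time_factor_le n hα
  set a : ℝ := (n : ℝ) / 2 + 1 with ha_def
  have ha : 0 < a := by positivity
  have hG : 0 < Real.Gamma a := Real.Gamma_pos_of_pos ha
  refine ⟨1 / √(4 * Real.pi) * (8 * K * (32 ^ a * Real.Gamma a)), by positivity,
    fun x y s t hs ht => ?_⟩
  set d := ‖x - y‖ with hd
  have hd0 : 0 ≤ d := norm_nonneg _
  set R : ℝ := ((t + s) ^ 2 + d ^ 2) / 16 with hR_def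
  have hR : 0 < R := by positivity
  obtain ⟨hint, hval⟩ := integrableOn_and_integral_inverse_gamma ha hR
  have hpt : ∀ u ∈ Ioi (0 : ℝ), ‖u ^ (-(3 : ℝ) / 2) * (1 - (t + s) ^ 2 / (2 * u)) *
      Real.exp (-(t + s) ^ 2 / (4 * u)) * Real.exp (-α * u) * V n j u x y‖ ≤
      8 * K * (u ^ (-(a + 1)) * Real.exp (-(R / u))) := by
    intro u hu
    have hu : 0 < u := hu
    have hV := abs_V_le n j hu x y
    have ht1 := hKu u hu
    set w := (t + s) ^ 2 / (8 * u) with hw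
    have hw0 : 0 ≤ w := by positivity
    have hw1 := abs_one_sub_mul_exp_neg_le hw0
    have hwR : Real.exp (-w) * Real.exp (-(d ^ 2 / (16 * u))) ≤ Real.exp (-(R / u)) := by
      rw [← Real.exp_add]
      apply Real.exp_le_exp.mpr
      have e : R / u = w / 2 + d ^ 2 / (16 * u) := by
        rw [hR_def, hw]; field_simp; ring
      rw [e]; linarith
    have hpow : u ^ (-(3 : ℝ) / 2) * u ^ (-((n : ℝ) + 1) / 2) = u ^ (-(a + 1)) := by
      rw [← Real.rpow_add hu]; congr 1; rw [ha_def]; ring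
    have e1 : (t + s) ^ 2 / (2 * u) = 4 * w := by rw [hw]; field_simp; norm_num
    have e2 : -(t + s) ^ 2 / (4 * u) = -(2 * w) := by rw [hw]; field_simp; norm_num
    rw [e1, e2]
    set S := √((1 + Real.exp (-2 * u)) / (1 - Real.exp (-2 * u))) *
        (Real.exp (-2 * u) / (Real.pi * (1 - Real.exp (-4 * u)))) ^ ((n : ℝ) / 2)
    have hp0 : 0 ≤ u ^ (-(3 : ℝ) / 2) := by positivity
    calc _ = u ^ (-(3 : ℝ) / 2) * (|1 - 4 * w| * Real.exp (-(2 * w))) *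
          (Real.exp (-α * u) * |V n j u x y|) := by
          simp only [Real.norm_eq_abs, abs_mul, Real.abs_exp, abs_of_nonneg hp0]
          ring
      _ ≤ u ^ (-(3 : ℝ) / 2) * (4 * Real.exp (-w)) *
          (Real.exp (-α * u) * (2 * S * Real.exp (-(d ^ 2 / (16 * u))))) := by gcongr
      _ = 8 * u ^ (-(3 : ℝ) / 2) * (S * Real.exp (-α * u)) *
          (Real.exp (-w) * Real.exp (-(d ^ 2 / (16 * u)))) := by ring
      _ ≤ 8 * u ^ (-(3 : ℝ) / 2) * (K * u ^ (-((n : ℝ) + 1) / 2)) *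
          Real.exp (-(R / u)) := by gcongr
      _ = _ := by rw [← hpow]; ring
  have hI := norm_integral_le_of_norm_le (hint.const_mul (8 * K))
    ((ae_restrict_iff' measurableSet_Ioi).mpr (Filter.Eventually.of_forall hpt))
  rw [integral_const_mul, hval] at hI
  have hD : 0 < s + t + d := by positivity
  have hRa : (1 / R) ^ a ≤ 32 ^ a / (s + t + d) ^ (n + 2) := by
    have h1 : 1 / R ≤ 32 / (s + t + d) ^ 2 := by
      rw [div_le_div_iff₀ hR (by positivity), hR_def]
      nlinarith [sq_nonneg (s + t - d)]
    refine (Real.rpow_le_rpow (by positivity) h1 ha.le).trans (le_of_eq ?_)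
    rw [Real.div_rpow (by norm_num) (by positivity), ← Real.rpow_natCast _ 2,
      ← Real.rpow_mul hD.le, ← Real.rpow_natCast _ (n + 2)]
    congr 2
    rw [ha_def]; push_cast; ring
  unfold Omj
  rw [abs_mul, abs_of_nonneg (by positivity : 0 ≤ t / √(4 * Real.pi)), ← Real.norm_eq_abs]
  calc _ ≤ t / √(4 * Real.pi) *
        (8 * K * (32 ^ a / (s + t + d) ^ (n + 2) * Real.Gamma a)) := by
        refine mul_le_mul_of_nonneg_left (hI.trans ?_) (by positivity)
        gcongr
    _ = _ := by ring
end
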